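/- Let S be a countably based, (2,ω)-divisible Cu-semigroup satisfying (O5), (O6) and (O7), let x ∈ S, and let u' ∈ L_x. Then there exists a strongly soft element w ∈ S such that u' ≪ w ≤ x ≤ ∞w and λ(w) = sup_{v' ∈ L_x} λ(v') for every functional λ ∈ F(S). -/

import Mathlib

open Set

/-- The way-below relation: `x ≪ y` if for every increasing sequence with a
supremum dominating `y`, some term of the sequence dominates `x`. -/
def WayBelow {S : Type*} [Preorder S] (x y : S) : Prop :=
  ∀ z : ℕ → S, Monotone z → ∀ s : S, IsLUB (Set.range z) s → y ≤ s → ∃ m : ℕ, x ≤ z m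

/-- A Cu-semigroup: a positively ordered commutative monoid satisfying (O1)-(O4). -/
class CuSemigroup (S : Type*) extends AddCommMonoid S, PartialOrder S where
  zero_le : ∀ x : S, 0 ≤ x
  add_mono : ∀ {a b c d : S}, a ≤ b → c ≤ d → a + c ≤ b + d
  O1 : ∀ z : ℕ → S, Monotone z → ∃ s : S, IsLUB (Set.range z) s
  O2 : ∀ x : S, ∃ z : ℕ → S, (∀ n, WayBelow (z n) (z (n + 1))) ∧ IsLUB (Set.range z) x
  O3 : ∀ {x' x y' y : S}, WayBelow x' x → WayBelow y' y → WayBelow (x' + y') (x + y)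
  O4 : ∀ (x y : ℕ → S), Monotone x → Monotone y → ∀ sx sy : S,
      IsLUB (Set.range x) sx → IsLUB (Set.range y) sy →
      IsLUB (Set.range fun n => x n + y n) (sx + sy)

variable {S : Type*}

lemma CuSemigroup.nsmul_mono [CuSemigroup S] (x : S) : Monotone fun n : ℕ => n • x := by
  intro n m h
  obtain ⟨k, rfl⟩ := Nat.exists_eq_add_of_le h
  show n • x ≤ (n + k) • x
  rw [add_nsmul]
  calc n • x = n • x + 0 := by rw [add_zero]
    _ ≤ n • x + k • x := CuSemigroup.add_mono le_rfl (CuSemigroup.zero_le _)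

/-- `infty x` is the supremum of the increasing sequence `n • x`, i.e. `∞x`. -/
noncomputable def infty [CuSemigroup S] (x : S) : S :=
  (CuSemigroup.O1 (fun n : ℕ => n • x) (CuSemigroup.nsmul_mono x)).choose

lemma infty_isLUB [CuSemigroup S] (x : S) :
    IsLUB (Set.range fun n : ℕ => n • x) (infty x) :=
  (CuSemigroup.O1 (fun n : ℕ => n • x) (CuSemigroup.nsmul_mono x)).choose_spec

/-- An element is strongly soft if every `x' ≪ x` admits `t` with `x' + t ≪ x`
and `x' ≪ ∞t`. -/
def StronglySoft [CuSemigroup S] (x : S) : Prop :=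
  ∀ x' : S, WayBelow x' x → ∃ t : S, WayBelow (x' + t) x ∧ WayBelow x' (infty t)

def SatisfiesO5 (S : Type*) [CuSemigroup S] : Prop :=
  ∀ x' x y' y z : S, WayBelow x' x → WayBelow y' y → x + y ≤ z →
    ∃ c : S, WayBelow y' c ∧ x' + c ≤ z ∧ z ≤ x + c

def SatisfiesO6 (S : Type*) [CuSemigroup S] : Prop :=
  ∀ x' x y z : S, WayBelow x' x → WayBelow x (y + z) →
    ∃ v w : S, v ≤ x ∧ v ≤ y ∧ w ≤ x ∧ w ≤ z ∧ x' ≤ v + w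

def SatisfiesO7 (S : Type*) [CuSemigroup S] : Prop :=
  ∀ x' x y' y w : S, WayBelow x' x → x ≤ w → WayBelow y' y → y ≤ w →
    ∃ z : S, WayBelow x' z ∧ WayBelow y' z ∧ z ≤ w ∧ z ≤ x + y

def TwoOmegaDivisible (S : Type*) [CuSemigroup S] : Prop :=
  ∀ x' x : S, WayBelow x' x → ∃ y : S, 2 • y ≤ x ∧ x' ≤ infty y

def WeaklyCancellative (S : Type*) [CuSemigroup S] : Prop :=
  ∀ x y z : S, WayBelow (x + z) (y + z) → WayBelow x y

def Separative (S : Type*) [CuSemigroup S] : Prop :=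
  ∀ x y t : S, WayBelow (x + t) (y + t) → WayBelow t (infty x) → WayBelow t (infty y) →
    WayBelow x y

def LeftSoftSeparative (S : Type*) [CuSemigroup S] : Prop :=
  ∀ x y t : S, StronglySoft x → WayBelow (x + t) (y + t) → WayBelow t (infty x) →
    WayBelow t (infty y) → WayBelow x y

def AlmostUnperforated (S : Type*) [CuSemigroup S] : Prop :=
  ∀ x y : S, (∃ n : ℕ, 1 ≤ n ∧ (n + 1) • x ≤ n • y) → x ≤ y

def CountablyBased (S : Type*) [CuSemigroup S] : Prop :=
  ∃ D : Set S, D.Countable ∧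
    ∀ x : S, ∃ z : ℕ → S, Monotone z ∧ (∀ n, z n ∈ D) ∧ IsLUB (Set.range z) x

/-- `Lset x` is the set `L_x = { u' : u' ≪ u ≪ x for some strongly soft u }`. -/
def Lset [CuSemigroup S] (x : S) : Set S :=
  { u' | ∃ u : S, StronglySoft u ∧ WayBelow u' u ∧ WayBelow u x }

/-- A functional on a Cu-semigroup: a monoid morphism to `[0,∞]` preserving order
and suprema of increasing sequences. -/
structure CuFunctional (S : Type*) [CuSemigroup S] where
  toFun : S → ENNReal
  map_zero : toFun 0 = 0
  map_add : ∀ x y : S, toFun (x + y) = toFun x + toFun y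
  mono : ∀ x y : S, x ≤ y → toFun x ≤ toFun y
  map_sup : ∀ z : ℕ → S, Monotone z → ∀ s : S, IsLUB (Set.range z) s →
    toFun s = ⨆ n, toFun (z n)

/-- Predicate version: `f : S → [0,∞]` is a functional on `S`. -/
def IsCuFunctional [CuSemigroup S] (f : S → ENNReal) : Prop :=
  f 0 = 0 ∧ (∀ x y : S, f (x + y) = f x + f y) ∧ (∀ x y : S, x ≤ y → f x ≤ f y) ∧
  (∀ z : ℕ → S, Monotone z → ∀ s : S, IsLUB (Set.range z) s → f s = ⨆ n, f (z n))

/-- Least upper bound of `A` computed within the subset `T`. -/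
def IsLUBIn [CuSemigroup S] (T : Set S) (A : Set S) (s : S) : Prop :=
  s ∈ T ∧ s ∈ upperBounds A ∧ ∀ b ∈ T, b ∈ upperBounds A → s ≤ b

/-- The way-below relation computed within the subset `T`. -/
def WayBelowIn [CuSemigroup S] (T : Set S) (x y : S) : Prop :=
  ∀ z : ℕ → S, Monotone z → (∀ n, z n ∈ T) → ∀ s : S, IsLUBIn T (Set.range z) s → y ≤ s →
    ∃ m : ℕ, x ≤ z m

/-- `T` is a sub-Cu-semigroup of `S`: a submonoid which is itself a Cu-semigroup
for the inherited order, such that the inclusion preserves suprema of increasing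
sequences and the way-below relation. -/
structure IsSubCuSemigroup [CuSemigroup S] (T : Set S) : Prop where
  zero_mem : (0 : S) ∈ T
  add_mem : ∀ {x y : S}, x ∈ T → y ∈ T → x + y ∈ T
  o1 : ∀ z : ℕ → S, Monotone z → (∀ n, z n ∈ T) → ∃ s : S, IsLUBIn T (Set.range z) s
  o2 : ∀ x ∈ T, ∃ z : ℕ → S, (∀ n, z n ∈ T) ∧ (∀ n, WayBelowIn T (z n) (z (n + 1))) ∧
        IsLUBIn T (Set.range z) x
  o3 : ∀ {x' x y' y : S}, x' ∈ T → x ∈ T → y' ∈ T → y ∈ T →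
        WayBelowIn T x' x → WayBelowIn T y' y → WayBelowIn T (x' + y') (x + y)
  o4 : ∀ (x y : ℕ → S), Monotone x → Monotone y → (∀ n, x n ∈ T) → (∀ n, y n ∈ T) →
        ∀ sx sy : S, IsLUBIn T (Set.range x) sx → IsLUBIn T (Set.range y) sy →
        IsLUBIn T (Set.range fun n => x n + y n) (sx + sy)
  incl_sup : ∀ z : ℕ → S, Monotone z → (∀ n, z n ∈ T) → ∀ s : S,
        IsLUBIn T (Set.range z) s → IsLUB (Set.range z) s
  incl_wayBelow : ∀ {x y : S}, x ∈ T → y ∈ T → WayBelowIn T x y → WayBelow x y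

def SatisfiesO5In [CuSemigroup S] (T : Set S) : Prop :=
  ∀ x' x y' y z : S, x' ∈ T → x ∈ T → y' ∈ T → y ∈ T → z ∈ T →
    WayBelowIn T x' x → WayBelowIn T y' y → x + y ≤ z →
    ∃ c ∈ T, WayBelowIn T y' c ∧ x' + c ≤ z ∧ z ≤ x + c

def SatisfiesO6In [CuSemigroup S] (T : Set S) : Prop :=
  ∀ x' x y z : S, x' ∈ T → x ∈ T → y ∈ T → z ∈ T →
    WayBelowIn T x' x → WayBelowIn T x (y + z) →
    ∃ v ∈ T, ∃ w ∈ T, v ≤ x ∧ v ≤ y ∧ w ≤ x ∧ w ≤ z ∧ x' ≤ v + w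

def SatisfiesO7In [CuSemigroup S] (T : Set S) : Prop :=
  ∀ x' x y' y w : S, x' ∈ T → x ∈ T → y' ∈ T → y ∈ T → w ∈ T →
    WayBelowIn T x' x → x ≤ w → WayBelowIn T y' y → y ≤ w →
    ∃ z ∈ T, WayBelowIn T x' z ∧ WayBelowIn T y' z ∧ z ≤ w ∧ z ≤ x + y

/-- `f` is a functional on the sub-Cu-semigroup `T` (values off `T` are irrelevant). -/
def IsFunctionalOn [CuSemigroup S] (T : Set S) (f : S → ENNReal) : Prop :=
  f 0 = 0 ∧
  (∀ x ∈ T, ∀ y ∈ T, f (x + y) = f x + f y) ∧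
  (∀ x ∈ T, ∀ y ∈ T, x ≤ y → f x ≤ f y) ∧
  (∀ z : ℕ → S, Monotone z → (∀ n, z n ∈ T) → ∀ s : S, IsLUBIn T (Set.range z) s →
    f s = ⨆ n, f (z n))

/-- An element is full if `x ≤ ∞e` for every `x`. -/
def IsFull [CuSemigroup S] (e : S) : Prop := ∀ x : S, x ≤ infty e

/-- Condition (R1) for `r`: comparison of `x` with `y` whenever
`λ(x) + r·λ(e) ≤ λ(y)` for all functionals. -/
def SatisfiesR1 (S : Type*) [CuSemigroup S] (e : S) (r : NNReal) : Prop :=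
  ∀ x y : S,
    (∀ lam : CuFunctional S, lam.toFun x + (r : ENNReal) * lam.toFun e ≤ lam.toFun y) → x ≤ y

/-- The radius of comparison of `(S, e)`. -/
noncomputable def rc (S : Type*) [CuSemigroup S] (e : S) : ENNReal :=
  ⨅ r ∈ {r : NNReal | 0 < r ∧ SatisfiesR1 S e r}, (r : ENNReal)

/-- Condition (R1) for the sub-Cu-semigroup `T`. -/
def SatisfiesR1On [CuSemigroup S] (T : Set S) (e : S) (r : NNReal) : Prop :=
  ∀ x ∈ T, ∀ y ∈ T,
    (∀ f : S → ENNReal, IsFunctionalOn T f → f x + (r : ENNReal) * f e ≤ f y) → x ≤ y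

/-- The radius of comparison of `(T, e)` for a sub-Cu-semigroup `T ⊆ S`. -/
noncomputable def rcOn [CuSemigroup S] (T : Set S) (e : S) : ENNReal :=
  ⨅ r ∈ {r : NNReal | 0 < r ∧ SatisfiesR1On T e r}, (r : ENNReal)

/-- `dim S ≤ n` in the sense of covering dimension of Cu-semigroups. -/
def DimLe (S : Type*) [CuSemigroup S] (n : ℕ) : Prop :=
  ∀ (x' x : S) (r : ℕ) (y : Fin r → S), WayBelow x' x → WayBelow x (∑ j, y j) →
    ∃ z : Fin r → Fin (n + 1) → S,
      (∀ j k, WayBelow (z j k) (y j)) ∧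
      WayBelow x' (∑ j, ∑ k, z j k) ∧
      (∀ k, WayBelow (∑ j, z j k) x)

/-- The covering dimension of a Cu-semigroup, in `ℕ ∪ {∞}`. -/
noncomputable def cuDim (S : Type*) [CuSemigroup S] : ℕ∞ :=
  ⨅ n ∈ {n : ℕ | DimLe S n}, (n : ℕ∞)

/-- `dim T ≤ n` for a sub-Cu-semigroup `T ⊆ S`. -/
def DimLeOn [CuSemigroup S] (T : Set S) (n : ℕ) : Prop :=
  ∀ (x' x : S), x' ∈ T → x ∈ T → ∀ (r : ℕ) (y : Fin r → S), (∀ j, y j ∈ T) →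
    WayBelowIn T x' x → WayBelowIn T x (∑ j, y j) →
    ∃ z : Fin r → Fin (n + 1) → S,
      (∀ j k, z j k ∈ T) ∧
      (∀ j k, WayBelowIn T (z j k) (y j)) ∧
      WayBelowIn T x' (∑ j, ∑ k, z j k) ∧
      (∀ k, WayBelowIn T (∑ j, z j k) x)

/-- The covering dimension of a sub-Cu-semigroup `T ⊆ S`. -/
noncomputable def cuDimOn [CuSemigroup S] (T : Set S) : ℕ∞ :=
  ⨅ n ∈ {n : ℕ | DimLeOn T n}, (n : ℕ∞)

namespace CuSemigroup

section Basic

variable [CuSemigroup S] {a b c x y z : S}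

lemma _root_.WayBelow.le (h : WayBelow x y) : x ≤ y := by
  obtain ⟨m, hm⟩ := h (fun _ => y) monotone_const y (by simp) le_rfl
  exact hm

lemma _root_.WayBelow.trans_le (h : WayBelow x y) (h' : y ≤ z) : WayBelow x z :=
  fun f hf s hs hzs => h f hf s hs (h'.trans hzs)

lemma _root_.LE.le.trans_wayBelow (h : x ≤ y) (h' : WayBelow y z) : WayBelow x z :=
  fun f hf s hs hzs => (h' f hf s hs hzs).imp fun _ hm => h.trans hm

lemma zero_wayBelow (x : S) : WayBelow 0 x :=
  fun _ _ _ _ _ => ⟨0, zero_le _⟩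

lemma le_self_add (x y : S) : x ≤ x + y := by
  simpa using add_mono (le_refl x) (zero_le y)

lemma nsmul_le_nsmul (n : ℕ) (h : x ≤ y) : n • x ≤ n • y := by
  induction n with
  | zero => simp
  | succ n ih => rw [succ_nsmul, succ_nsmul]; exact add_mono ih h

lemma nsmul_wayBelow (n : ℕ) (h : WayBelow x y) : WayBelow (n • x) (n • y) := by
  induction n with
  | zero => rw [zero_nsmul]; exact zero_wayBelow _
  | succ n ih => rw [succ_nsmul, succ_nsmul]; exact O3 ih h

/-- Every element is the supremum of an increasing sequence of elements way below it. -/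
lemma exists_seq (x : S) : ∃ f : ℕ → S, Monotone f ∧ (∀ n, WayBelow (f n) (f (n + 1))) ∧
    (∀ n, WayBelow (f n) x) ∧ IsLUB (Set.range f) x := by
  obtain ⟨f, hf, hx⟩ := O2 x
  exact ⟨f, monotone_nat_of_le_succ fun n => (hf n).le, hf,
    fun n => (hf n).trans_le (hx.1 ⟨n + 1, rfl⟩), hx⟩

lemma exists_between (h : WayBelow x z) : ∃ y, WayBelow x y ∧ WayBelow y z := by
  obtain ⟨f, hf, hff, hfz, hz⟩ := exists_seq z
  obtain ⟨m, hm⟩ := h f hf z hz le_rfl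
  exact ⟨f (m + 1), hm.trans_wayBelow (hff m), hfz _⟩

lemma exists_wayBelow_upper (ha : WayBelow a x) (hb : WayBelow b x) :
    ∃ y, WayBelow y x ∧ a ≤ y ∧ b ≤ y := by
  obtain ⟨f, hf, -, hfx, hx⟩ := exists_seq x
  obtain ⟨m, hm⟩ := ha f hf x hx le_rfl
  obtain ⟨k, hk⟩ := hb f hf x hx le_rfl
  exact ⟨f (max m k), hfx _, hm.trans (hf (le_max_left _ _)), hk.trans (hf (le_max_right _ _))⟩

lemma exists_wayBelow_add (h : WayBelow x (y + z)) :
    ∃ y' z', WayBelow y' y ∧ WayBelow z' z ∧ x ≤ y' + z' := by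
  obtain ⟨f, hf, -, hfy, hy⟩ := exists_seq y
  obtain ⟨g, hg, -, hgz, hz⟩ := exists_seq z
  obtain ⟨m, hm⟩ := h _ (fun i j hij => add_mono (hf hij) (hg hij)) _
    (O4 f g hf hg y z hy hz) le_rfl
  exact ⟨f m, g m, hfy m, hgz m, hm⟩

lemma isLUB_nsmul (n : ℕ) {f : ℕ → S} (hf : Monotone f) (hx : IsLUB (Set.range f) x) :
    IsLUB (Set.range fun j => n • f j) (n • x) := by
  induction n with
  | zero => simp
  | succ n ih =>
    simp only [succ_nsmul]
    exact O4 _ _ (fun i j hij => nsmul_le_nsmul n (hf hij)) hf _ _ ih hx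

lemma exists_wayBelow_nsmul {n : ℕ} (h : WayBelow y (n • x)) (ha : WayBelow a x) :
    ∃ x', WayBelow x' x ∧ a ≤ x' ∧ y ≤ n • x' := by
  obtain ⟨f, hf, -, hfx, hx⟩ := exists_seq x
  obtain ⟨m, hm⟩ := ha f hf x hx le_rfl
  obtain ⟨k, hk⟩ := h _ (fun i j hij => nsmul_le_nsmul n (hf hij)) _ (isLUB_nsmul n hf hx) le_rfl
  exact ⟨f (max m k), hfx _, hm.trans (hf (le_max_left _ _)),
    hk.trans (nsmul_le_nsmul n (hf (le_max_right _ _)))⟩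

lemma nsmul_le_infty (n : ℕ) (x : S) : n • x ≤ infty x :=
  (infty_isLUB x).1 ⟨n, rfl⟩

lemma le_infty (x : S) : x ≤ infty x := by
  simpa using nsmul_le_infty 1 x

lemma add_le_infty (ha : a ≤ infty x) (hb : b ≤ infty x) : a + b ≤ infty x := by
  refine (add_mono ha hb).trans ?_
  refine (O4 _ _ (nsmul_mono x) (nsmul_mono x) _ _ (infty_isLUB x) (infty_isLUB x)).2 ?_
  rintro _ ⟨n, rfl⟩
  simpa only [add_nsmul] using nsmul_le_infty (n + n) x

lemma nsmul_le_infty_of_le (n : ℕ) (ha : a ≤ infty x) : n • a ≤ infty x := by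
  induction n with
  | zero => rw [zero_nsmul]; exact zero_le _
  | succ n ih => rw [succ_nsmul]; exact add_le_infty ih ha

lemma infty_le_infty (ha : a ≤ infty x) : infty a ≤ infty x := by
  refine (infty_isLUB a).2 ?_
  rintro _ ⟨n, rfl⟩
  exact nsmul_le_infty_of_le n ha

lemma le_infty_trans (ha : a ≤ infty b) (hb : b ≤ infty c) : a ≤ infty c :=
  ha.trans (infty_le_infty hb)

lemma exists_wayBelow_infty (h : WayBelow y (infty x)) :
    ∃ x', WayBelow x' x ∧ y ≤ infty x' := by
  obtain ⟨z, hyz, hz⟩ := exists_between h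
  obtain ⟨n, hn⟩ := hz _ (nsmul_mono x) _ (infty_isLUB x) le_rfl
  obtain ⟨x', hx', -, h'⟩ := exists_wayBelow_nsmul (hyz.trans_le hn) (zero_wayBelow x)
  exact ⟨x', hx', h'.trans (nsmul_le_infty n x')⟩

end Basic

section Soft

variable [CuSemigroup S]

lemma stronglySoft_add {v s : S} (hs : StronglySoft s) (hv : v ≤ infty s) :
    StronglySoft (v + s) := by
  intro z hz
  obtain ⟨z₂, hz₂, hz₂'⟩ := exists_between hz
  obtain ⟨v', s', hv', hs', hle⟩ := exists_wayBelow_add hz₂'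
  obtain ⟨s₂, hs₂, hvs₂⟩ := exists_wayBelow_infty (hv'.trans_le hv)
  obtain ⟨s₃, hs₃, h₁, h₂⟩ := exists_wayBelow_upper hs' hs₂
  obtain ⟨t, ht, ht'⟩ := hs s₃ hs₃
  refine ⟨t, ?_, hz₂.trans_le ?_⟩
  · refine LE.le.trans_wayBelow ?_ (O3 hv' ht)
    rw [← add_assoc]
    exact add_mono (hz₂.le.trans (hle.trans (add_mono le_rfl h₁))) le_rfl
  · exact hle.trans (add_le_infty
      (le_infty_trans hvs₂ (h₂.trans ht'.le)) (h₁.trans ht'.le))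

/-- The supremum of a sequence whose increments absorb the earlier terms is strongly soft. -/
lemma stronglySoft_of_isLUB {f : ℕ → S} {w : S} (hf : Monotone f) (hw : IsLUB (Set.range f) w)
    (h : ∀ n, ∃ t, f n + t ≤ f (n + 1) ∧ f n ≤ infty t) : StronglySoft w := by
  intro z hz
  obtain ⟨z₂, hz₂, hz₂w⟩ := exists_between hz
  obtain ⟨n, hn⟩ := hz₂w f hf w hw le_rfl
  obtain ⟨t, ht, ht'⟩ := h n
  obtain ⟨z₃, hz₃, hz₃'⟩ := exists_between hz₂
  obtain ⟨t', htt, hzt⟩ := exists_wayBelow_infty (hz₃'.trans_le (hn.trans ht'))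
  exact ⟨t', (O3 hz₂ htt).trans_le ((add_mono hn le_rfl).trans (ht.trans (hw.1 ⟨n + 1, rfl⟩))),
    hz₃.trans_le hzt⟩

/-- `HasRoom x a` says that `a` has a complement inside `x` generating an ideal containing `a`. -/
def HasRoom (x a : S) : Prop := ∃ t, a + t ≤ x ∧ a ≤ infty t

lemma HasRoom.le {x a : S} (h : HasRoom x a) : a ≤ x := by
  obtain ⟨t, ht, -⟩ := h
  exact (le_self_add a t).trans ht

lemma exists_two_pow_nsmul_le (hdiv : TwoOmegaDivisible S) (m : ℕ) {x' x : S}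
    (h : WayBelow x' x) : ∃ y, (2 ^ m) • y ≤ x ∧ x' ≤ infty y := by
  induction m generalizing x' x with
  | zero => exact ⟨x, by simp, h.le.trans (le_infty x)⟩
  | succ m ih =>
    obtain ⟨x₂, hx₂, hx₂'⟩ := exists_between h
    obtain ⟨y, hy, hxy⟩ := hdiv x₂ x hx₂'
    obtain ⟨y', hy', hxy'⟩ := exists_wayBelow_infty (hx₂.trans_le hxy)
    obtain ⟨z, hz, hyz⟩ := ih hy'
    refine ⟨z, ?_, le_infty_trans hxy' hyz⟩
    rw [pow_succ, mul_nsmul]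
    exact (nsmul_le_nsmul 2 hz).trans hy

lemma exists_nsmul_le (hdiv : TwoOmegaDivisible S) (k : ℕ) {x' x : S}
    (h : WayBelow x' x) : ∃ y, k • y ≤ x ∧ x' ≤ infty y := by
  obtain ⟨y, hy, hxy⟩ := exists_two_pow_nsmul_le hdiv k h
  exact ⟨y, (nsmul_mono y Nat.lt_two_pow_self.le).trans hy, hxy⟩

/-- An element with room in `x` can be enlarged, keeping room, so that it almost dominates a
given element way below `x`. -/
lemma exists_hasRoom_nsmul_le (hdiv : TwoOmegaDivisible S)
    (hO5 : SatisfiesO5 S) (hO6 : SatisfiesO6 S) (hO7 : SatisfiesO7 S) {x a A b : S}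
    (haA : WayBelow a A) (hA : HasRoom x A) (hb : WayBelow b x) (M : ℕ) :
    ∃ e, HasRoom x e ∧ WayBelow a e ∧ M • b ≤ (M + 1) • e := by
  obtain ⟨s₁, hAs, hAs'⟩ := hA
  obtain ⟨a₁, ha₁, ha₁A⟩ := exists_between haA
  obtain ⟨a₂, ha₂, ha₂₁⟩ := exists_between ha₁
  obtain ⟨a₃, ha₃, ha₃₂⟩ := exists_between ha₂
  obtain ⟨s, hs, ha₁s⟩ := exists_wayBelow_infty (ha₁A.trans_le hAs')
  obtain ⟨c, hsc, hc, hxc⟩ := hO5 a₂ a₁ s s₁ x ha₂₁ hs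
    ((add_mono ha₁A.le le_rfl).trans hAs)
  have hxc' : x ≤ infty c :=
    hxc.trans (add_le_infty (le_infty_trans ha₁s (hsc.le.trans (le_infty c))) (le_infty c))
  obtain ⟨b₁, hb₁, hb₁x⟩ := exists_between hb
  obtain ⟨b₂, hb₂, hb₂x⟩ := exists_between hb₁x
  have ha₃x : WayBelow a₃ x :=
    ha₃₂.trans_le ((le_self_add a₂ c).trans hc)
  obtain ⟨y, hyx, ha₃y, hb₂y⟩ := exists_wayBelow_upper ha₃x hb₂x
  obtain ⟨y₁, hyy₁, hy₁x⟩ := exists_between hyx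
  obtain ⟨c', hc'c, hy₁c'⟩ := exists_wayBelow_infty (hy₁x.trans_le hxc')
  obtain ⟨r, hr, hc'r⟩ := exists_nsmul_le hdiv (M + 1) hc'c
  obtain ⟨r₂, hr₂, hyr₂⟩ := exists_wayBelow_infty (hyy₁.trans_le (le_infty_trans hy₁c' hc'r))
  obtain ⟨r₁, hr₂₁, hr₁⟩ := exists_between hr₂
  obtain ⟨e, he, hre, hxe⟩ := hO5 r₂ r₁ (a₃ + M • r₁) (a₂ + M • r) x hr₂₁
    (O3 ha₃₂ (nsmul_wayBelow M hr₁)) (by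
      refine le_trans ?_ hc
      calc r₁ + (a₂ + M • r) ≤ r + (a₂ + M • r) := add_mono hr₁.le le_rfl
        _ = a₂ + (M + 1) • r := by rw [succ_nsmul]; abel
        _ ≤ a₂ + c := add_mono le_rfl hr)
  obtain ⟨p, q, hpb, hpe, hqb, hqr, hbpq⟩ := hO6 b₁ b₂ e r₁ hb₂
    (hb₂x.trans_le (by rw [add_comm]; exact hxe))
  obtain ⟨p', q', hp', hq', hbpq'⟩ := exists_wayBelow_add (hb₁.trans_le hbpq)
  obtain ⟨e', h₁, h₂, h₃, h₄⟩ := hO7 (a + M • q') (a₃ + M • q) p' p e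
    (O3 ha₃ (nsmul_wayBelow M hq'))
    ((add_mono le_rfl (nsmul_le_nsmul M hqr)).trans he.le) hp' hpe
  refine ⟨e', ⟨r₂, ?_, ?_⟩, (le_self_add _ _).trans_wayBelow h₁, ?_⟩
  · rw [add_comm]
    exact (add_mono le_rfl h₃).trans hre
  · exact h₄.trans (add_le_infty (add_le_infty (ha₃y.trans hyr₂)
      (nsmul_le_infty_of_le M ((hqb.trans hb₂y).trans hyr₂))) ((hpb.trans hb₂y).trans hyr₂))
  · have hq'e : M • q' ≤ e' := by
      refine le_trans ?_ h₁.le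
      rw [add_comm]
      exact le_self_add _ _
    calc M • b ≤ M • (p' + q') := nsmul_le_nsmul M hbpq'
      _ = M • p' + M • q' := nsmul_add _ _ _
      _ ≤ M • e' + e' := add_mono (nsmul_le_nsmul M h₂.le) hq'e
      _ = (M + 1) • e' := (succ_nsmul _ _).symm

lemma exists_hasRoom_add (hdiv : TwoOmegaDivisible S) {x a A : S}
    (haA : WayBelow a A) (hA : HasRoom x A) :
    ∃ t B, HasRoom x B ∧ WayBelow (a + t) B ∧ a ≤ infty t := by
  obtain ⟨s, hAs, hAs'⟩ := hA
  obtain ⟨a₁, ha₁, ha₁A⟩ := exists_between haA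
  obtain ⟨s', hs', ha₁s'⟩ := exists_wayBelow_infty (ha₁A.trans_le hAs')
  obtain ⟨r, hr, hs'r⟩ := hdiv s' s hs'
  have ha₁r : a₁ ≤ infty r := le_infty_trans ha₁s' hs'r
  obtain ⟨t, htr, hat⟩ := exists_wayBelow_infty (ha₁.trans_le ha₁r)
  refine ⟨t, a₁ + r, ⟨r, ?_, add_le_infty ha₁r (le_infty r)⟩, O3 ha₁ htr, hat⟩
  rw [add_assoc, ← two_nsmul]
  exact (add_mono ha₁A.le hr).trans hAs

lemma exists_soft_step (hdiv : TwoOmegaDivisible S)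
    (hO5 : SatisfiesO5 S) (hO6 : SatisfiesO6 S) (hO7 : SatisfiesO7 S) {x a A b : S}
    (haA : WayBelow a A) (hA : HasRoom x A) (hb : WayBelow b x) (M : ℕ) :
    ∃ a' A', WayBelow a' A' ∧ HasRoom x A' ∧ (∃ t, a + t ≤ a' ∧ a ≤ infty t) ∧
      M • b ≤ (M + 1) • a' := by
  obtain ⟨t, B, hB, haB, hat⟩ := exists_hasRoom_add hdiv haA hA
  obtain ⟨b₁, hb₁, hb₁x⟩ := exists_between hb
  obtain ⟨e, he, hae, hbe⟩ := exists_hasRoom_nsmul_le hdiv hO5 hO6 hO7 haB hB hb₁x M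
  obtain ⟨a', ha', h₁, h₂⟩ := exists_wayBelow_nsmul ((nsmul_wayBelow M hb₁).trans_le hbe) hae
  exact ⟨a', e, ha', he, ⟨t, h₁, hat⟩, h₂⟩

/-- An element with room in `x` lies below the supremum of a sequence of such elements which is
strongly soft and almost dominates `x`. -/
lemma exists_soft_seq (hdiv : TwoOmegaDivisible S)
    (hO5 : SatisfiesO5 S) (hO6 : SatisfiesO6 S) (hO7 : SatisfiesO7 S) {x a A : S}
    (haA : WayBelow a A) (hA : HasRoom x A) :
    ∃ (f : ℕ → S) (w : S), Monotone f ∧ IsLUB (Set.range f) w ∧ f 0 = a ∧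
      (∀ n, ∃ B, WayBelow (f n) B ∧ HasRoom x B) ∧ StronglySoft w ∧
      ∀ b, WayBelow b x → ∃ N, ∀ n, N ≤ n → n • b ≤ (n + 1) • w := by
  obtain ⟨g, hg, -, hgx, hglub⟩ := exists_seq x
  have hstep : ∀ (n : ℕ) (p : {p : S × S // WayBelow p.1 p.2 ∧ HasRoom x p.2}),
      ∃ q : {p : S × S // WayBelow p.1 p.2 ∧ HasRoom x p.2},
        (∃ t, p.1.1 + t ≤ q.1.1 ∧ p.1.1 ≤ infty t) ∧ n • g n ≤ (n + 1) • q.1.1 := by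
    rintro n ⟨⟨a, A⟩, haA, hA⟩
    obtain ⟨a', A', h₁, h₂, h₃, h₄⟩ := exists_soft_step hdiv hO5 hO6 hO7 haA hA (hgx n) n
    exact ⟨⟨(a', A'), h₁, h₂⟩, h₃, h₄⟩
  choose F hF hFg using hstep
  let G : ℕ → {p : S × S // WayBelow p.1 p.2 ∧ HasRoom x p.2} :=
    fun n => Nat.rec ⟨(a, A), haA, hA⟩ F n
  have hmono : Monotone fun n => (G n).1.1 := monotone_nat_of_le_succ fun n => by
    obtain ⟨t, ht, -⟩ := hF n (G n)
    exact (le_self_add _ t).trans ht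
  obtain ⟨w, hw⟩ := O1 _ hmono
  refine ⟨fun n => (G n).1.1, w, hmono, hw, rfl, fun n => ⟨_, (G n).2⟩,
    stronglySoft_of_isLUB hmono hw fun n => hF n (G n), fun b hb => ?_⟩
  obtain ⟨N, hN⟩ := hb g hg x hglub le_rfl
  exact ⟨N, fun n hn => (nsmul_le_nsmul n (hN.trans (hg hn))).trans
    ((hFg n (G n)).trans (nsmul_le_nsmul _ (hw.1 ⟨n + 1, rfl⟩)))⟩

lemma le_infty_of_almost_le {x w : S}
    (h : ∀ b, WayBelow b x → ∃ N, ∀ n : ℕ, N ≤ n → n • b ≤ (n + 1) • w) : x ≤ infty w := by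
  obtain ⟨g, -, -, hgx, hg⟩ := exists_seq x
  refine hg.2 ?_
  rintro _ ⟨m, rfl⟩
  obtain ⟨N, hN⟩ := h _ (hgx m)
  calc g m = 1 • g m := (one_nsmul _).symm
    _ ≤ (N + 1) • g m := nsmul_mono _ (Nat.le_add_left 1 N)
    _ ≤ (N + 1 + 1) • w := hN _ N.le_succ
    _ ≤ infty w := nsmul_le_infty _ _

lemma _root_.CuFunctional.map_nsmul (lam : CuFunctional S) (n : ℕ) (x : S) :
    lam.toFun (n • x) = n * lam.toFun x := by
  induction n with
  | zero => simp [lam.map_zero]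
  | succ n ih => rw [succ_nsmul, lam.map_add, ih]; push_cast; ring

lemma _root_.CuFunctional.le_of_almost_le (lam : CuFunctional S) {x w : S}
    (h : ∀ b, WayBelow b x → ∃ N, ∀ n : ℕ, N ≤ n → n • b ≤ (n + 1) • w) :
    lam.toFun x ≤ lam.toFun w := by
  obtain ⟨g, hgm, -, hgx, hg⟩ := exists_seq x
  rw [lam.map_sup g hgm x hg]
  refine iSup_le fun m => ?_
  obtain ⟨N, hN⟩ := h _ (hgx m)
  have key : ∀ n : ℕ, N ≤ n → n * lam.toFun (g m) ≤ n * lam.toFun w + lam.toFun w := by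
    intro n hn
    have := lam.mono _ _ (hN n hn)
    rw [lam.map_nsmul, lam.map_nsmul] at this
    simpa [add_mul] using this
  by_contra! hlt
  obtain ⟨r, hr, hr'⟩ := ENNReal.lt_iff_exists_add_pos_lt.1 hlt
  have hw : lam.toFun w ≠ ⊤ := hlt.ne_top
  obtain ⟨n, hn⟩ := ENNReal.exists_nat_mul_gt (a := (r : ENNReal)) (by simpa using hr.ne') hw
  have h₁ := key (max N n) (le_max_left _ _)
  have h₂ : ((max N n : ℕ) : ENNReal) * lam.toFun w + ((max N n : ℕ) : ENNReal) * r ≤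
      ((max N n : ℕ) : ENNReal) * lam.toFun w + lam.toFun w := by
    rw [← mul_add]
    exact (mul_le_mul_right hr'.le _).trans h₁
  have h₃ := (ENNReal.add_le_add_iff_left
    (ENNReal.mul_ne_top (ENNReal.natCast_ne_top _) hw)).1 h₂
  refine absurd (hn.trans_le ?_) (not_lt.2 h₃)
  gcongr
  exact le_max_right _ _

lemma mem_Lset_of_hasRoom (hdiv : TwoOmegaDivisible S)
    (hO5 : SatisfiesO5 S) (hO6 : SatisfiesO6 S) (hO7 : SatisfiesO7 S) {x a A : S}
    (haA : WayBelow a A) (hA : HasRoom x A) : a ∈ Lset x := by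
  obtain ⟨t, hAt, hAt'⟩ := hA
  obtain ⟨a₁, ha₁, ha₁A⟩ := exists_between haA
  obtain ⟨t', ht', ha₁t'⟩ := exists_wayBelow_infty (ha₁A.trans_le hAt')
  obtain ⟨f, s, -, hs, -, hfB, hsoft, halm⟩ := exists_soft_seq hdiv hO5 hO6 hO7
    (zero_wayBelow (0 : S)) (x := t') ⟨0, by simpa using zero_le t', zero_le _⟩
  have hst : s ≤ t' := by
    refine hs.2 ?_
    rintro _ ⟨n, rfl⟩
    obtain ⟨B, hB, hB'⟩ := hfB n
    exact hB.le.trans hB'.le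
  exact ⟨a₁ + s, stronglySoft_add hsoft (le_infty_trans ha₁t' (le_infty_of_almost_le halm)),
    ha₁.trans_le (le_self_add _ _), (O3 ha₁A (hst.trans_wayBelow ht')).trans_le hAt⟩

end Soft

end CuSemigroup

/-- In a countably based, (2,ω)-divisible Cu-semigroup satisfying
(O5)-(O7), for `x ∈ S` and `u' ∈ L_x` there is a strongly soft `w` with
`u' ≪ w ≤ x ≤ ∞w` and `λ(w) = sup_{v' ∈ L_x} λ(v')` for every functional `λ`. -/
theorem exists_soft_sup_of_Lset {S : Type*} [CuSemigroup S]
    (hcb : CountablyBased S) (hdiv : TwoOmegaDivisible S)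
    (hO5 : SatisfiesO5 S) (hO6 : SatisfiesO6 S) (hO7 : SatisfiesO7 S)
    (x : S) {u' : S} (hu' : u' ∈ Lset x) :
    ∃ w : S, StronglySoft w ∧ WayBelow u' w ∧ w ≤ x ∧ x ≤ infty w ∧
      ∀ lam : CuFunctional S, lam.toFun w = ⨆ v' ∈ Lset x, lam.toFun v' := by
  obtain ⟨u, hu, huu', hux⟩ := hu'
  obtain ⟨u₁, hu₁, hu₁u⟩ := CuSemigroup.exists_between huu'
  obtain ⟨u₀, hu₀, hu₀₁⟩ := CuSemigroup.exists_between hu₁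
  obtain ⟨t, ht, ht'⟩ := hu u₁ hu₁u
  obtain ⟨f, w, hf, hw, hf0, hfB, hsoft, halm⟩ := CuSemigroup.exists_soft_seq hdiv hO5 hO6 hO7
    hu₀₁ ⟨t, ht.le.trans hux.le, ht'.le⟩
  have hwx : w ≤ x := by
    refine hw.2 ?_
    rintro _ ⟨n, rfl⟩
    obtain ⟨B, hB, hB'⟩ := hfB n
    exact hB.le.trans hB'.le
  refine ⟨w, hsoft, hu₀.trans_le (hf0 ▸ hw.1 ⟨0, rfl⟩), hwx,
    CuSemigroup.le_infty_of_almost_le halm, fun lam => le_antisymm ?_ ?_⟩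
  · rw [lam.map_sup f hf w hw]
    refine iSup_le fun n => ?_
    obtain ⟨B, hB, hB'⟩ := hfB n
    exact le_iSup₂_of_le (f n) (CuSemigroup.mem_Lset_of_hasRoom hdiv hO5 hO6 hO7 hB hB') le_rfl
  · refine iSup₂_le fun v hv => ?_
    obtain ⟨v₁, -, hv₁, hv₁x⟩ := hv
    exact (lam.mono _ _ (hv₁.le.trans hv₁x.le)).trans (lam.le_of_almost_le halm)
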